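/- arXiv:2406.12573 — 5 statements merged into one kernel-verified Lean document; each statement's English description precedes it below -/
import Mathlib

section
/- Let W̄ ⊆ ℝⁿ be a nonempty convex set and W ⊆ ℝⁿ a nonempty set. Let (Δ_A^d, Δ_B^d) with Δ_A^d ∈ ℝ^{n×n}, Δ_B^d ∈ ℝ^{n×m}, d = 1,…,n_D, be given and set D = conv{(Δ_A^d, Δ_B^d) : d = 1,…,n_D}. Fix an integer i ≥ 0, vectors z ∈ ℝⁿ, v ∈ ℝᵐ, p ∈ ℝⁿ, matrices Φ^e_j ∈ ℝ^{n×n} and Φ^ν_j ∈ ℝ^{m×n} for j = 0,…,i−1, and matrices Σ_j ∈ ℝ^{n×n} for j = 0,…,i. For each d define ψ^d = Δ_A^d z + Δ_B^d v − p and Ψ^d_j = Δ_A^d Φ^e_j + Δ_B^d Φ^ν_j − Σ_j (j = 0,…,i−1). If for every d = 1,…,n_D the inclusion {ψ^d} ⊕ ⨁_{j=0}^{i−1} Ψ^d_j W̄ ⊕ W ⊆ Σ_i W̄ holds, then for every (Δ_A, Δ_B) ∈ D one has {Δ_A z + Δ_B v − p} ⊕ ⨁_{j=0}^{i−1} (Δ_A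 Φ^e_j + Δ_B Φ^ν_j) W̄ ⊕ W ⊆ ⨁_{j=0}^{i} Σ_j W̄. -/
open Pointwise

noncomputable section

abbrev Vec (n : ℕ) := Fin n → ℝ
abbrev Mat (n m : ℕ) := Matrix (Fin n) (Fin m) ℝ

/-- Image of a set under a matrix map. -/
def mset {n m : ℕ} (M : Mat n m) (S : Set (Vec m)) : Set (Vec n) := M.mulVec '' S

theorem convex_mset {n m : ℕ} (M : Mat n m) {S : Set (Vec m)} (hS : Convex ℝ S) :
    Convex ℝ (mset M S) :=
  hS.linear_image M.mulVecLin

/-- The point of the vertex-wise Minkowski sum selected by `u` and `w`, as a function of the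
uncertain matrices. -/
def tubeResidual {n m : ℕ} (z : Vec n) (v : Vec m) (p : Vec n)
    (Φe : ℕ → Mat n n) (Φν : ℕ → Mat m n) (Sg : ℕ → Mat n n)
    (u : ℕ → Vec n) (w : Vec n) (i : ℕ) (Δ : Mat n n × Mat n m) : Vec n :=
  Δ.1.mulVec z + Δ.2.mulVec v - p
    + ∑ j ∈ Finset.range i, (Δ.1 * Φe j + Δ.2 * Φν j - Sg j).mulVec (u j) + w

theorem tubeResidual_convex_combination {n m : ℕ} (z : Vec n) (v : Vec m) (p : Vec n)
    (Φe : ℕ → Mat n n) (Φν : ℕ → Mat m n) (Sg : ℕ → Mat n n)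
    (u : ℕ → Vec n) (w : Vec n) (i : ℕ) (Δ Δ' : Mat n n × Mat n m) {a b : ℝ}
    (hab : a + b = 1) :
    tubeResidual z v p Φe Φν Sg u w i (a • Δ + b • Δ') =
      a • tubeResidual z v p Φe Φν Sg u w i Δ + b • tubeResidual z v p Φe Φν Sg u w i Δ' := by
  obtain rfl : b = 1 - a := by linarith
  simp only [tubeResidual, Prod.fst_add, Prod.snd_add, Prod.smul_fst, Prod.smul_snd,
    Matrix.add_mul, Matrix.smul_mul, Matrix.add_mulVec, Matrix.sub_mulVec, Matrix.smul_mulVec,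
    Finset.sum_add_distrib, Finset.sum_sub_distrib, ← Finset.smul_sum]
  module

theorem convex_tubeResidual_preimage {n m : ℕ} (z : Vec n) (v : Vec m) (p : Vec n)
    (Φe : ℕ → Mat n n) (Φν : ℕ → Mat m n) (Sg : ℕ → Mat n n)
    (u : ℕ → Vec n) (w : Vec n) (i : ℕ) {S : Set (Vec n)} (hS : Convex ℝ S) :
    Convex ℝ {Δ : Mat n n × Mat n m | tubeResidual z v p Φe Φν Sg u w i Δ ∈ S} := by
  intro Δ hΔ Δ' hΔ' a b ha hb hab
  rw [Set.mem_ofPred_eq, tubeResidual_convex_combination z v p Φe Φν Sg u w i Δ Δ' hab]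
  exact hS hΔ hΔ' ha hb hab

/-- Lemma 1 of the paper: if the disturbance-tube inclusion
`{ψ^d} ⊕ ⨁_{j<i} Ψ^d_j W̄ ⊕ W ⊆ Σ_i W̄` holds at every vertex `d` of the uncertainty set,
then the containment condition
`{Δ_A z + Δ_B v − p} ⊕ ⨁_{j<i} (Δ_A Φ^e_j + Δ_B Φ^ν_j) W̄ ⊕ W ⊆ ⨁_{j≤i} Σ_j W̄` holds for
every `(Δ_A, Δ_B)` in the convex hull of the vertices. -/
theorem vertex_inclusion_implies_containment {n m nD : ℕ}
    (Wbar W : Set (Vec n)) (hWbarNe : Wbar.Nonempty) (hWbarConv : Convex ℝ Wbar)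
    (hWNe : W.Nonempty)
    (ΔA : Fin nD → Mat n n) (ΔB : Fin nD → Mat n m)
    (i : ℕ) (z : Vec n) (v : Vec m) (p : Vec n)
    (Φe : ℕ → Mat n n) (Φν : ℕ → Mat m n) (Sg : ℕ → Mat n n)
    (hvertex : ∀ d : Fin nD,
      ({(ΔA d).mulVec z + (ΔB d).mulVec v - p} : Set (Vec n))
          + (∑ j ∈ Finset.range i, mset (ΔA d * Φe j + ΔB d * Φν j - Sg j) Wbar)
          + W
        ⊆ mset (Sg i) Wbar) :
    ∀ Δ ∈ convexHull ℝ (Set.range fun d => (ΔA d, ΔB d)),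
      ({Δ.1.mulVec z + Δ.2.mulVec v - p} : Set (Vec n))
          + (∑ j ∈ Finset.range i, mset (Δ.1 * Φe j + Δ.2 * Φν j) Wbar)
          + W
        ⊆ ∑ j ∈ Finset.range (i + 1), mset (Sg j) Wbar := by
  intro Δ hΔ x hx
  obtain ⟨y, ⟨c, rfl, s, hs, rfl⟩, w, hw, rfl⟩ := hx
  obtain ⟨g, hg, rfl⟩ := (Set.mem_finsetSum _ _ _).1 hs
  choose! u hu hgu using fun j (hj : j ∈ Finset.range i) => hg hj
  have key : convexHull ℝ (Set.range fun d => (ΔA d, ΔB d)) ⊆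
      {Δ | tubeResidual z v p Φe Φν Sg u w i Δ ∈ mset (Sg i) Wbar} := by
    refine convexHull_min ?_ (convex_tubeResidual_preimage z v p Φe Φν Sg u w i
      (convex_mset (Sg i) hWbarConv))
    rintro _ ⟨d, rfl⟩
    refine hvertex d (Set.add_mem_add (Set.add_mem_add rfl ?_) hw)
    exact Set.finsetSum_mem_finsetSum _ _ _ fun j hj => Set.mem_image_of_mem _ (hu j hj)
  have hres := key hΔ
  rw [Finset.sum_range_succ]
  refine Set.mem_add.2 ⟨∑ j ∈ Finset.range i, (Sg j).mulVec (u j),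
    Set.finsetSum_mem_finsetSum _ _ _ fun j hj => Set.mem_image_of_mem _ (hu j hj),
    _, hres, ?_⟩
  rw [← Finset.sum_congr rfl hgu]
  simp only [tubeResidual, Matrix.sub_mulVec, Finset.sum_sub_distrib]
  abel
end
end

section
/- Let A ∈ ℝ^{n×n}, B ∈ ℝ^{n×m}, K_f ∈ ℝ^{m×n}, a scalar α ≥ 0, an integer N ≥ 1, sets W̄ ⊆ ℝⁿ and Z_f ⊆ ℝⁿ, matrices Φ^e_{N,j} ∈ ℝ^{n×n}, Φ^ν_{N,j} ∈ ℝ^{m×n}, Ξ_j ∈ ℝ^{n×n} for j = 0,…,N−1, and a scalar σ_N with Φ^e_{N,N−1} = σ_N·I_n. Assume: (a) α(A + BK_f)Z_f ⊕ ΓW̄ ⊆ αZ_f, where Γ = AΦ^e_{N,0} + BΦ^ν_{N,0} + Ξ_0; and (b) Φ^e_{N,j−1} = AΦ^e_{N,j} + BΦ^ν_{N,j} + Ξ_j for all j = 1,…,N−1. Then the set X_f = αZ_f ⊕ F_N(Φ^e), where F_N(Φ^e) = ⨁_{j=0}^{N−1} Φ^e_{N,j}W̄, is robust positively invariant under the terminal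 control law: for every z_N ∈ αZ_f and every w̄_0,…,w̄_N ∈ W̄, setting e_N = Σ_{j=0}^{N−1} Φ^e_{N,j} w̄_j, x_N = z_N + e_N, ν_N = Σ_{j=0}^{N−1} Φ^ν_{N,j} w̄_j, and η_N = Σ_{j=0}^{N−1} Ξ_j w̄_j + σ_N w̄_N, the successor state x_{N+1} = A x_N + B(K_f z_N + ν_N) + η_N belongs to X_f = αZ_f ⊕ F_N(Φ^e). -/
open Pointwise

noncomputable section

/-- Lemma 2 of the paper: under conditions (a) and (b), the set
`X_f = α Z_f ⊕ F_N(Φ^e)` with `F_N(Φ^e) = ⨁_{j<N} Φ^e_{N,j} W̄` is robust positively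
invariant for the terminal control law `κ_f(x) = K_f z + ν`. Here `Φe j`, `Φν j`, `Ξ j`
stand for `Φ^e_{N,j}`, `Φ^ν_{N,j}`, `Ξ_j`. -/
theorem terminal_set_RPI {n m : ℕ} (N : ℕ) (hN : 1 ≤ N)
    (A : Mat n n) (B : Mat n m) (Kf : Mat m n)
    (α : ℝ) (hα : 0 ≤ α)
    (Wbar Zf : Set (Vec n))
    (Φe : ℕ → Mat n n) (Φν : ℕ → Mat m n) (Ξ : ℕ → Mat n n) (σN : ℝ)
    (hdiag : Φe (N - 1) = σN • (1 : Mat n n))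
    (ha : α • mset (A + B * Kf) Zf + mset (A * Φe 0 + B * Φν 0 + Ξ 0) Wbar ⊆ α • Zf)
    (hb : ∀ j, 1 ≤ j → j ≤ N - 1 → Φe (j - 1) = A * Φe j + B * Φν j + Ξ j) :
    ∀ zN ∈ α • Zf, ∀ w : ℕ → Vec n, (∀ j ≤ N, w j ∈ Wbar) →
      A.mulVec (zN + ∑ j ∈ Finset.range N, (Φe j).mulVec (w j))
          + B.mulVec (Kf.mulVec zN + ∑ j ∈ Finset.range N, (Φν j).mulVec (w j))
          + (∑ j ∈ Finset.range N, (Ξ j).mulVec (w j) + σN • w N)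
        ∈ α • Zf + ∑ j ∈ Finset.range N, mset (Φe j) Wbar := by
  rintro _ ⟨z, hz, rfl⟩ w hw
  obtain ⟨k, rfl⟩ : ∃ k, N = k + 1 := ⟨N - 1, by omega⟩
  rw [Nat.add_sub_cancel] at hdiag hb
  have hsucc : A.mulVec (α • z + ∑ j ∈ Finset.range (k + 1), (Φe j).mulVec (w j))
        + B.mulVec (Kf.mulVec (α • z) + ∑ j ∈ Finset.range (k + 1), (Φν j).mulVec (w j))
        + (∑ j ∈ Finset.range (k + 1), (Ξ j).mulVec (w j) + σN • w (k + 1))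
      = (α • (A + B * Kf).mulVec z + (A * Φe 0 + B * Φν 0 + Ξ 0).mulVec (w 0))
        + ∑ j ∈ Finset.range (k + 1), (Φe j).mulVec (w (j + 1)) := by
    have hgain : ∑ j ∈ Finset.range (k + 1), (A * Φe j + B * Φν j + Ξ j).mulVec (w j)
        = (A * Φe 0 + B * Φν 0 + Ξ 0).mulVec (w 0)
          + ∑ j ∈ Finset.range k, (Φe j).mulVec (w (j + 1)) := by
      rw [Finset.sum_range_succ', add_comm]
      congr 1
      refine Finset.sum_congr rfl fun j hj => ?_
      rw [← hb (j + 1) (by omega) (Finset.mem_range.mp hj), Nat.add_sub_cancel]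
    have hlast : (Φe k).mulVec (w (k + 1)) = σN • w (k + 1) := by
      rw [hdiag, Matrix.smul_mulVec, Matrix.one_mulVec]
    rw [Finset.sum_range_succ (fun j => (Φe j).mulVec (w (j + 1))), hlast,
      add_assoc (α • _), ← add_assoc (Matrix.mulVec _ (w 0)), ← hgain]
    simp only [Matrix.add_mulVec, ← Matrix.mulVec_mulVec, Matrix.mulVec_add, Matrix.mulVec_smul,
      Matrix.mulVec_sum, Finset.sum_add_distrib, smul_add]
    abel
  rw [hsucc]
  exact Set.add_mem_add
    (ha (Set.add_mem_add (Set.smul_mem_smul_set (Set.mem_image_of_mem _ hz))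
      (Set.mem_image_of_mem _ (hw 0 (Nat.zero_le _)))))
    (Set.finsetSum_mem_finsetSum _ _ _ fun j hj =>
      Set.mem_image_of_mem _ (hw (j + 1) (Finset.mem_range.mp hj)))
end
end

section
/- Suppose the SLTMPC constraint system with horizon N ≥ 1 is feasible at a state x ∈ ℝⁿ, and let (z*, v*, p*, α*, Φ^{e*}, Φ^{ν*}, Σ*, Ξ*) be any feasible solution (e.g., an optimal one). Then for every (Δ_A, Δ_B) ∈ D and every w ∈ W, the SLTMPC constraint system is feasible at the successor state x⁺ = (A + Δ_A)x + (B + Δ_B)v₀* + w. In particular, the set X_feas of states at which the SLTMPC constraint system is feasible is robust positively invariant for the uncertain system in closed loop with the MPC control law κ_MPC(x) = v₀*: x ∈ X_feas implies x⁺ ∈ X_feas for all w ∈ W and (Δ_A, Δ_B) ∈ D. -/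
open Pointwise

noncomputable section

/-- Pontryagin set difference: `A ⊖ B = {x | x + b ∈ A for all b ∈ B}`. -/
def pontryagin {V : Type*} [Add V] (A B : Set V) : Set V := {x | ∀ b ∈ B, x + b ∈ A}

/-- A (compact, convex) polytope: the convex hull of finitely many points. -/
def IsPolytope {n : ℕ} (S : Set (Vec n)) : Prop :=
  ∃ F : Finset (Vec n), S = convexHull ℝ (F : Set (Vec n))

/-- Decision variables of the recursively feasible filter-based SLTMPC problem (31):
nominal states `z`, nominal inputs `v`, nominal disturbances `p`, terminal scaling `α`,
error system responses `Φe i j = Φ^e_{i,j}`, `Φν i j = Φ^ν_{i,j}`, disturbance filter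
`Sg i j = Σ_{i,j}` with diagonal scalings `σ`, and terminal filter parameters `Ξ`. -/
structure SLTMPCSol (n m : ℕ) where
  z : ℕ → Vec n
  v : ℕ → Vec m
  p : ℕ → Vec n
  α : ℝ
  Φe : ℕ → ℕ → Mat n n
  Φν : ℕ → ℕ → Mat m n
  Sg : ℕ → ℕ → Mat n n
  σ : ℕ → ℝ
  Ξ : ℕ → Mat n n

/-- The constraint system (31b)–(31k) of the recursively feasible filter-based SLTMPC
problem at state `x` with horizon `N`. -/
def SLTMPCConstraints {n m nD : ℕ} (N : ℕ)
    (A : Mat n n) (B : Mat n m)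
    (ΔA : Fin nD → Mat n n) (ΔB : Fin nD → Mat n m)
    (W Wbar X Zf : Set (Vec n)) (U : Set (Vec m)) (Kf : Mat m n)
    (x : Vec n) (s : SLTMPCSol n m) : Prop :=
  -- initial condition
  s.z 0 = x ∧
  -- nominal dynamics
  (∀ i < N, s.z (i + 1) = A.mulVec (s.z i) + B.mulVec (s.v i) + s.p i) ∧
  -- diagonal structure of the disturbance filter
  (∀ i < N, s.Sg (i + 1) i = s.σ (i + 1) • (1 : Mat n n)) ∧
  -- SLP affine constraint (block diagonal and strictly-lower blocks)
  (∀ i < N, s.Φe (i + 1) i = s.σ (i + 1) • (1 : Mat n n)) ∧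
  (∀ i, 1 ≤ i → i ≤ N - 1 → ∀ j < i,
    s.Φe (i + 1) j = A * s.Φe i j + B * s.Φν i j + s.Sg (i + 1) j) ∧
  -- terminal system response recursion (31e)
  (∀ j, 1 ≤ j → j ≤ N - 1 →
    s.Φe N (j - 1) = A * s.Φe N j + B * s.Φν N j + s.Ξ j) ∧
  -- tightened state and input constraints
  (∀ i < N, s.z i ∈ pontryagin X (∑ j ∈ Finset.range i, mset (s.Φe i j) Wbar)) ∧
  (∀ i < N, s.v i ∈ pontryagin U (∑ j ∈ Finset.range i, mset (s.Φν i j) Wbar)) ∧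
  -- terminal constraints
  0 ≤ s.α ∧
  s.z N ∈ s.α • Zf ∧
  s.α • Zf ⊆ pontryagin X (∑ j ∈ Finset.range N, mset (s.Φe N j) Wbar) ∧
  s.α • mset Kf Zf ⊆ pontryagin U (∑ j ∈ Finset.range N, mset (s.Φν N j) Wbar) ∧
  s.α • mset (A + B * Kf) Zf
    ⊆ pontryagin (s.α • Zf) (mset (A * s.Φe N 0 + B * s.Φν N 0 + s.Ξ 0) Wbar) ∧
  -- disturbance inclusion constraints
  (∀ d : Fin nD, ∀ i < N,
    ({(ΔA d).mulVec (s.z i) + (ΔB d).mulVec (s.v i) - s.p i} : Set (Vec n))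
        + (∑ j ∈ Finset.range i,
            mset (ΔA d * s.Φe i j + ΔB d * s.Φν i j - s.Sg (i + 1) j) Wbar)
        + W
      ⊆ s.σ (i + 1) • Wbar) ∧
  -- terminal disturbance inclusion constraint
  (∀ d : Fin nD,
    s.α • mset (ΔA d + ΔB d * Kf) Zf
        + (∑ j ∈ Finset.range N,
            mset (ΔA d * s.Φe N j + ΔB d * s.Φν N j - s.Ξ j) Wbar)
        + W
      ⊆ s.σ N • Wbar)

lemma sum_mset_succ {N n m : ℕ} (M : ℕ → Mat n m) (S : Set (Vec m)) {w : Vec m} (hw : w ∈ S)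
    {b : Vec n} (hb : b ∈ ∑ j ∈ Finset.range N, mset (M (j + 1)) S) :
    (M 0).mulVec w + b ∈ ∑ j ∈ Finset.range (N + 1), mset (M j) S := by
  rw [Finset.sum_range_succ', add_comm]
  exact Set.add_mem_add (Set.mem_image_of_mem _ hw) hb

lemma add_mem_pontryagin_shift {N n m : ℕ} {X : Set (Vec n)} {S : Set (Vec m)}
    (M : ℕ → Mat n m) {y : Vec n} {w : Vec m}
    (hy : y ∈ pontryagin X (∑ j ∈ Finset.range (N + 1), mset (M j) S)) (hw : w ∈ S) :
    y + (M 0).mulVec w ∈ pontryagin X (∑ j ∈ Finset.range N, mset (M (j + 1)) S) := by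
  intro b hb
  rw [add_assoc]
  exact hy _ (sum_mset_succ M S hw hb)

lemma singleton_add_sum_mset_shift {N n m : ℕ} {C W T : Set (Vec n)} {S : Set (Vec m)}
    (M : ℕ → Mat n m) (h : C + (∑ j ∈ Finset.range (N + 1), mset (M j) S) + W ⊆ T)
    {c : Vec n} (hc : c ∈ C) {w : Vec m} (hw : w ∈ S) :
    ({c + (M 0).mulVec w} : Set (Vec n))
      + (∑ j ∈ Finset.range N, mset (M (j + 1)) S) + W ⊆ T := by
  rintro _ ⟨_, ⟨_, rfl, b, hb, rfl⟩, d, hd, rfl⟩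
  refine h (Set.add_mem_add ?_ hd)
  simp only [add_assoc]
  exact Set.add_mem_add hc (sum_mset_succ M S hw hb)

lemma mulVec_add_mulVec_sub_mem_of_mem_convexHull {ι : Type*} {n m : ℕ}
    {ΔA : ι → Mat n n} {ΔB : ι → Mat n m} {T : Set (Vec n)} (hT : Convex ℝ T)
    {z c : Vec n} {v : Vec m}
    (h : ∀ d, (ΔA d).mulVec z + (ΔB d).mulVec v + c ∈ T)
    {Δ : Mat n n × Mat n m} (hΔ : Δ ∈ convexHull ℝ (Set.range fun d => (ΔA d, ΔB d))) :
    Δ.1.mulVec z + Δ.2.mulVec v + c ∈ T := by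
  have hconv : Convex ℝ
      {Δ : Mat n n × Mat n m | Δ.1.mulVec z + Δ.2.mulVec v + c ∈ T} := by
    intro P hP Q hQ a b ha hb hab
    have key := hT hP hQ ha hb hab
    simp only [Set.mem_ofPred_eq]
    convert key using 1
    have hc : c = a • c + b • c := by rw [← add_smul, hab, one_smul]
    simp only [Prod.fst_add, Prod.snd_add, Prod.smul_fst, Prod.smul_snd, Matrix.add_mulVec,
      Matrix.smul_mulVec, smul_add]
    nth_rewrite 1 [hc]
    abel
  exact convexHull_min (by rintro _ ⟨d, rfl⟩; exact h d) hconv hΔ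

/-- The shifted candidate for horizon `k + 1`, given the realised auxiliary disturbance `w` and a
point `ζ` of the terminal set with `s.z (k + 1) = s.α • ζ`. -/
def shiftedSol {n m : ℕ} (k : ℕ) (A : Mat n n) (B : Mat n m) (Kf : Mat m n)
    (s : SLTMPCSol n m) (w ζ : Vec n) : SLTMPCSol n m where
  z i := if i ≤ k then s.z (i + 1) + (s.Φe (i + 1) 0).mulVec w
    else s.α • (A + B * Kf).mulVec ζ
      + (A * s.Φe (k + 1) 0 + B * s.Φν (k + 1) 0 + s.Ξ 0).mulVec w
  v i := (if i < k then s.v (i + 1) else s.α • Kf.mulVec ζ) + (s.Φν (i + 1) 0).mulVec w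
  p i := if i < k then s.p (i + 1) + (s.Sg (i + 2) 0).mulVec w else (s.Ξ 0).mulVec w
  α := s.α
  Φe i j := if i ≤ k then s.Φe (i + 1) (j + 1) else s.Φe (k + 1) j
  Φν i j := if i ≤ k then s.Φν (i + 1) (j + 1) else s.Φν (k + 1) j
  Sg i j := if i ≤ k then s.Sg (i + 1) (j + 1)
    else if j < k then s.Ξ (j + 1) else s.σ (k + 1) • (1 : Mat n n)
  σ i := if i ≤ k then s.σ (i + 1) else s.σ (k + 1)
  Ξ := s.Ξ

/-- Theorem 1 of the paper: recursive feasibility of the recursively feasible filter-based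
SLTMPC problem (31). If the constraint system is feasible at `x` with feasible solution
`s`, then for every `(Δ_A, Δ_B)` in the uncertainty set `D` and every `w ∈ W` it is
feasible at the successor state `x⁺ = (A + Δ_A)x + (B + Δ_B)v₀* + w`; hence the feasible
set is robust positively invariant in closed loop with `κ_MPC(x) = v₀*`. -/
theorem sltmpc_recursive_feasibility {n m nD : ℕ} (N : ℕ) (hN : 1 ≤ N)
    (A : Mat n n) (B : Mat n m)
    (ΔA : Fin nD → Mat n n) (ΔB : Fin nD → Mat n m)
    (W Wbar X Zf : Set (Vec n)) (U : Set (Vec m)) (Kf : Mat m n)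
    -- W is a compact convex polytope
    (hW : IsPolytope W)
    -- X, U are compact polytopes containing the origin in their interiors
    (hX : IsPolytope X) (hX0 : (0 : Vec n) ∈ interior X)
    (hU : IsPolytope U) (hU0 : (0 : Vec m) ∈ interior U)
    -- W̄ is a compact convex polytope containing the origin in its interior
    (hWbar : IsPolytope Wbar) (hWbar0 : (0 : Vec n) ∈ interior Wbar)
    -- Z_f ⊆ X is a nonempty RPI set for the auxiliary system with controller K_f
    (hZfX : Zf ⊆ X) (hZfNe : Zf.Nonempty)
    (hZfRPI : mset (A + B * Kf) Zf + Wbar ⊆ Zf)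
    (hZfU : mset Kf Zf ⊆ U)
    -- a feasible (e.g. optimal) solution at x
    (x : Vec n) (s : SLTMPCSol n m)
    (hfeas : SLTMPCConstraints N A B ΔA ΔB W Wbar X Zf U Kf x s) :
    ∀ Δ ∈ convexHull ℝ (Set.range fun d => (ΔA d, ΔB d)), ∀ w ∈ W,
      ∃ s' : SLTMPCSol n m,
        SLTMPCConstraints N A B ΔA ΔB W Wbar X Zf U Kf
          ((A + Δ.1).mulVec x + (B + Δ.2).mulVec (s.v 0) + w) s' := by
  intro Δ hΔ w hw
  obtain ⟨k, rfl⟩ : ∃ k, N = k + 1 := ⟨N - 1, by omega⟩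
  obtain ⟨h0, hdyn, hSg, hΦd, hΦ, hΞ, hz, hv, hα, hzN, hX', hU', hΓ, hdist, hterm⟩ := hfeas
  obtain ⟨ζ, hζ, hzζ⟩ := hzN
  simp only at hzζ
  have hconv : Convex ℝ Wbar := by
    obtain ⟨F, rfl⟩ := hWbar
    exact convex_convexHull ℝ _
  have hreal : Δ.1.mulVec x + Δ.2.mulVec (s.v 0) + (w - s.p 0) ∈ s.σ 1 • Wbar := by
    refine mulVec_add_mulVec_sub_mem_of_mem_convexHull (hconv.smul _) (fun d => ?_) hΔ
    have := hdist d 0 (by omega)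
    rw [Finset.sum_range_zero, add_zero, h0] at this
    have h2 := this (Set.add_mem_add (Set.mem_singleton _) hw)
    convert h2 using 1
    abel
  obtain ⟨ω, hω, hωeq⟩ := hreal
  simp only at hωeq
  refine ⟨shiftedSol k A B Kf s ω ζ, ?_, ?_, ?_, ?_, ?_, ?_, ?_, ?_, hα, ?_, ?_, ?_, ?_, ?_, ?_⟩
  · have h1 := hdyn 0 (by omega)
    simp only [shiftedSol, Nat.zero_le, if_true, zero_add] at h1 ⊢
    rw [h1, hΦd 0 (by omega), h0, zero_add, Matrix.smul_mulVec, Matrix.one_mulVec, hωeq,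
      Matrix.add_mulVec, Matrix.add_mulVec]
    abel
  · intro i hi
    rcases (show i < k ∨ i = k by omega) with h | rfl
    · simp only [shiftedSol, if_pos h, if_pos h.le, if_pos (Nat.succ_le_of_lt h)]
      rw [hdyn (i + 1) (by omega), hΦ (i + 1) (by omega) (by omega) 0 (by omega)]
      simp only [Matrix.add_mulVec, Matrix.mulVec_add, ← Matrix.mulVec_mulVec]
      abel
    · simp only [shiftedSol, le_refl, if_true, lt_irrefl, if_false, Nat.not_succ_le_self]
      rw [← hzζ]
      simp only [Matrix.add_mulVec, Matrix.mulVec_add, ← Matrix.mulVec_mulVec, Matrix.mulVec_smul,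
        smul_add]
      abel
  · intro i hi
    rcases (show i < k ∨ i = k by omega) with h | rfl
    · simpa only [shiftedSol, if_pos (Nat.succ_le_of_lt h)] using hSg (i + 1) (by omega)
    · simp only [shiftedSol, lt_irrefl, if_false, Nat.not_succ_le_self]
  · intro i hi
    rcases (show i < k ∨ i = k by omega) with h | rfl
    · simpa only [shiftedSol, if_pos (Nat.succ_le_of_lt h)] using hΦd (i + 1) (by omega)
    · simpa only [shiftedSol, if_false, Nat.not_succ_le_self] using hΦd i (by omega)
  · intro i hi1 hi j hj
    rcases (show i < k ∨ i = k by omega) with h | rfl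
    · simpa only [shiftedSol, if_pos h.le, if_pos (Nat.succ_le_of_lt h)] using
        hΦ (i + 1) (by omega) (by omega) (j + 1) (by omega)
    · simpa only [shiftedSol, if_false, Nat.not_succ_le_self, le_refl, if_true, if_pos hj,
        Nat.add_sub_cancel] using
        hΞ (j + 1) (by omega) (by omega)
  · simpa only [shiftedSol, if_false, Nat.not_succ_le_self] using hΞ
  · intro i hi
    have hi' : i ≤ k := by omega
    simp only [shiftedSol, if_pos hi']
    refine add_mem_pontryagin_shift (s.Φe (i + 1)) ?_ hω
    rcases (show i < k ∨ i = k by omega) with h | rfl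
    · exact hz (i + 1) (by omega)
    · exact hX' ⟨ζ, hζ, hzζ⟩
  · intro i hi
    have hi' : i ≤ k := by omega
    simp only [shiftedSol, if_pos hi']
    refine add_mem_pontryagin_shift (s.Φν (i + 1)) ?_ hω
    rcases (show i < k ∨ i = k by omega) with h | rfl
    · simpa only [if_pos h] using hv (i + 1) (by omega)
    · simpa only [lt_irrefl, if_false] using
        hU' (Set.smul_mem_smul_set (Set.mem_image_of_mem _ hζ))
  · simp only [shiftedSol, if_false, Nat.not_succ_le_self]
    exact hΓ (Set.smul_mem_smul_set (Set.mem_image_of_mem _ hζ)) _ (Set.mem_image_of_mem _ hω)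
  · simpa only [shiftedSol, if_false, Nat.not_succ_le_self] using hX'
  · simpa only [shiftedSol, if_false, Nat.not_succ_le_self] using hU'
  · simpa only [shiftedSol, if_false, Nat.not_succ_le_self] using hΓ
  · intro d i hi
    rcases (show i < k ∨ i = k by omega) with h | rfl
    · simp only [shiftedSol, if_pos h, if_pos h.le, if_pos (Nat.succ_le_of_lt h)]
      convert singleton_add_sum_mset_shift
        (fun j => ΔA d * s.Φe (i + 1) j + ΔB d * s.Φν (i + 1) j - s.Sg (i + 2) j)
        (hdist d (i + 1) (by omega)) (Set.mem_singleton _) hω using 4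
      simp only [Matrix.add_mulVec, Matrix.sub_mulVec, Matrix.mulVec_add, ← Matrix.mulVec_mulVec]
      abel
    · simp only [shiftedSol, le_refl, if_true, lt_irrefl, if_false, Nat.not_succ_le_self]
      convert singleton_add_sum_mset_shift
        (fun j => ΔA d * s.Φe (i + 1) j + ΔB d * s.Φν (i + 1) j - s.Ξ j)
        (hterm d) (Set.smul_mem_smul_set (Set.mem_image_of_mem _ hζ)) hω using 3
      · rw [← hzζ]
        simp only [Matrix.add_mulVec, Matrix.sub_mulVec, Matrix.mulVec_add, ← Matrix.mulVec_mulVec,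
          Matrix.mulVec_smul, smul_add, Set.singleton_eq_singleton_iff]
        abel
      · refine Finset.sum_congr rfl fun j hj => ?_
        rw [if_pos (Finset.mem_range.1 hj)]
  · simpa only [shiftedSol, if_false, Nat.not_succ_le_self] using hterm
end
end

section
/- Consider scalars α ≥ 0 and β ≥ 0, matrices A ∈ ℝ^{n×n} and Γ ∈ ℝ^{n×n}, a nonempty polytope X = {x ∈ ℝⁿ : H_x x ≤ h_x} with H_x ∈ ℝ^{n_x×n}, a polytope parameterized by H_y ∈ ℝ^{n_y×n} and h_y ∈ ℝ^{n_y} with βY defined as {y ∈ ℝⁿ : H_y y ≤ βh_y}, and a nonempty compact convex set Z ⊂ ℝⁿ. Then the inclusion αAX ⊆ βY ⊖ ΓZ holds if and only if there exists a matrix Λ ∈ ℝ^{n_y×n_x} with Λ ≥ 0 entrywise such that ΛH_x = αH_yA and Λh_x ≤ βh_y − h_Z(ΓᵀH_yᵀ), where h_Z(ΓᵀH_yᵀ) ∈ ℝ^{n_y} is the vector whose r-th entry is the support function of Z evaluated at Γᵀ times the transpose of the r-th row of H_y, i.e., sup_{z∈Z} (H_yΓz)_r. -/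
open Pointwise

noncomputable section

/-- **Farkas' lemma** for finitely many linear functionals on a real vector space. -/
theorem exists_nonneg_sum_smul_eq_of_forall_le {V : Type*} [AddCommGroup V] [Module ℝ V] {m : ℕ}
    (f : Fin m → V →ₗ[ℝ] ℝ) (g : V →ₗ[ℝ] ℝ)
    (h : ∀ x, (∀ i, f i x ≤ 0) → g x ≤ 0) :
    ∃ l : Fin m → ℝ, (∀ i, 0 ≤ l i) ∧ ∀ x, g x = ∑ i, l i * f i x := by
  induction m generalizing g with
  | zero =>
    refine ⟨0, by simp, fun x => ?_⟩
    have h₁ := h x (by simp)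
    have h₂ := h (-x) (by simp)
    simp only [map_neg] at h₂
    simp only [Finset.univ_eq_empty, Finset.sum_empty]
    linarith
  | succ m ih =>
    by_cases hm : ∀ x, (∀ i : Fin m, f i.succ x ≤ 0) → g x ≤ 0
    · obtain ⟨l, hl, hg⟩ := ih (fun i => f i.succ) g hm
      refine ⟨Fin.cons 0 l, fun i => ?_, fun x => ?_⟩
      · cases i using Fin.cases <;> simp [hl]
      · simp [Fin.sum_univ_succ, hg x]
    · push Not at hm
      obtain ⟨v, hv, hgv⟩ := hm
      have hv₀ : 0 < f 0 v := by
        by_contra! hc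
        exact absurd (h v (fun i => Fin.cases hc hv i)) (not_le.mpr hgv)
      obtain ⟨l, hl, hg⟩ := ih (fun i => f i.succ - (f i.succ v / f 0 v) • f 0)
        (g - (g v / f 0 v) • f 0) (fun x hx => by
          have hy := h (x - (f 0 x / f 0 v) • v) (fun i => by
            cases i using Fin.cases with
            | zero => simp [hv₀.ne']
            | succ i =>
              have := hx i
              simp only [LinearMap.sub_apply, LinearMap.smul_apply, smul_eq_mul, map_sub,
                map_smul] at this ⊢
              convert this using 2
              ring)
          simp only [LinearMap.sub_apply, LinearMap.smul_apply, smul_eq_mul, map_sub,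
            map_smul] at hy ⊢
          convert hy using 2
          ring)
      refine ⟨Fin.cons (g v / f 0 v - ∑ i, l i * (f i.succ v / f 0 v)) l, fun i => ?_,
        fun x => ?_⟩
      · cases i using Fin.cases with
        | zero =>
          have hs : ∑ i, l i * (f i.succ v / f 0 v) ≤ 0 :=
            Finset.sum_nonpos fun i _ => mul_nonpos_of_nonneg_of_nonpos (hl i)
              (div_nonpos_of_nonpos_of_nonneg (hv i) hv₀.le)
          have := div_pos hgv hv₀
          simp only [Fin.cons_zero]
          linarith
        | succ i => simpa using hl i
      · have := hg x
        simp only [LinearMap.sub_apply, LinearMap.smul_apply, smul_eq_mul, mul_sub,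
          Finset.sum_sub_distrib, ← mul_assoc, ← Finset.sum_mul] at this
        simp only [Fin.sum_univ_succ, Fin.cons_zero, Fin.cons_succ]
        linarith

/-- **Affine Farkas' lemma**: a linear inequality valid on a nonempty polyhedron is a nonnegative
combination of the defining inequalities. -/
theorem exists_nonneg_sum_smul_eq_of_forall_le_on_polyhedron {V : Type*} [AddCommGroup V]
    [Module ℝ V] {m : ℕ} (f : Fin m → V →ₗ[ℝ] ℝ) (b : Fin m → ℝ) (g : V →ₗ[ℝ] ℝ) (c : ℝ)
    (hne : ∃ x, ∀ i, f i x ≤ b i) (h : ∀ x, (∀ i, f i x ≤ b i) → g x ≤ c) :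
    ∃ l : Fin m → ℝ, (∀ i, 0 ≤ l i) ∧ (∀ x, g x = ∑ i, l i * f i x) ∧ ∑ i, l i * b i ≤ c := by
  obtain ⟨x₀, hx₀⟩ := hne
  let F : Fin (m + 1) → V × ℝ →ₗ[ℝ] ℝ :=
    Fin.cons (-LinearMap.snd ℝ V ℝ)
      (fun i => f i ∘ₗ LinearMap.fst ℝ V ℝ - b i • LinearMap.snd ℝ V ℝ)
  obtain ⟨l, hl, hg⟩ := exists_nonneg_sum_smul_eq_of_forall_le F
    (g ∘ₗ LinearMap.fst ℝ V ℝ - c • LinearMap.snd ℝ V ℝ) (by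
      rintro ⟨x, t⟩ hx
      have ht : 0 ≤ t := by simpa [F] using hx 0
      have hf : ∀ i, f i x ≤ b i * t := fun i => by simpa [F] using hx i.succ
      suffices g x ≤ c * t by simpa using this
      rcases ht.eq_or_lt with rfl | ht
      · by_contra! hgx
        simp only [mul_zero] at hgx hf
        have hs : 0 ≤ (|c - g x₀| + 1) / g x := by positivity
        have hle := h (x₀ + ((|c - g x₀| + 1) / g x) • x) (fun i => by
          have := mul_nonpos_of_nonneg_of_nonpos hs (hf i)
          simp only [map_add, map_smul, smul_eq_mul]
          linarith [hx₀ i])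
        simp only [map_add, map_smul, smul_eq_mul, div_mul_cancel₀ _ hgx.ne'] at hle
        linarith [le_abs_self (c - g x₀)]
      · have hle := h (t⁻¹ • x) (fun i => by
          rw [map_smul, smul_eq_mul, inv_mul_le_iff₀ ht]
          linarith [hf i])
        rw [map_smul, smul_eq_mul, inv_mul_le_iff₀ ht] at hle
        linarith)
  refine ⟨fun i => l i.succ, fun i => hl _, fun x => ?_, ?_⟩
  · simpa [F, Fin.sum_univ_succ] using hg (x, 0)
  · have := hg (0, 1)
    simp only [F, Fin.sum_univ_succ, LinearMap.sub_apply, LinearMap.comp_apply,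
      LinearMap.smul_apply, LinearMap.neg_apply, LinearMap.fst_apply, LinearMap.snd_apply,
      Fin.cons_zero, Fin.cons_succ, map_zero, zero_sub, smul_eq_mul, mul_one, mul_neg,
      Finset.sum_neg_distrib] at this
    linarith [hl 0]

/-- Lemma 3 of the paper: the inclusion `αA X ⊆ βY ⊖ ΓZ` holds if and only if there is an
entrywise nonnegative matrix `Λ` with `Λ Hx = α Hy A` and `Λ hx ≤ β hy − h_Z(Γᵀ Hyᵀ)`. -/
theorem terminal_inclusion_iff {n nx ny : ℕ}
    (α β : ℝ) (hα : 0 ≤ α) (hβ : 0 ≤ β)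
    (A Γ : Mat n n)
    (Hx : Matrix (Fin nx) (Fin n) ℝ) (hx : Fin nx → ℝ)
    (Hy : Matrix (Fin ny) (Fin n) ℝ) (hy : Fin ny → ℝ)
    (hXne : {x : Vec n | Hx.mulVec x ≤ hx}.Nonempty)
    (Z : Set (Vec n)) (hZne : Z.Nonempty) (hZcompact : IsCompact Z) (hZconvex : Convex ℝ Z) :
    α • mset A {x : Vec n | Hx.mulVec x ≤ hx}
        ⊆ pontryagin {y : Vec n | Hy.mulVec y ≤ β • hy} (mset Γ Z) ↔
      ∃ Λ : Matrix (Fin ny) (Fin nx) ℝ,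
        (∀ r c, 0 ≤ Λ r c) ∧
        Λ * Hx = α • (Hy * A) ∧
        Λ.mulVec hx ≤ β • hy - (fun r => sSup ((fun z => (Hy * Γ).mulVec z r) '' Z)) := by
  have hmem : ∀ x z : Vec n, Hy.mulVec (α • A.mulVec x + Γ.mulVec z) =
      (α • (Hy * A)).mulVec x + (Hy * Γ).mulVec z := fun x z => by
    simp [Matrix.mulVec_add, Matrix.mulVec_smul, Matrix.smul_mulVec, Matrix.mulVec_mulVec]
  constructor
  · intro hsub
    have key : ∀ r, ∃ l : Fin nx → ℝ, (∀ i, 0 ≤ l i) ∧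
        (∀ x : Vec n, (α • (Hy * A)).mulVec x r = ∑ i, l i * Hx.mulVec x i) ∧
        ∑ i, l i * hx i ≤ β * hy r - sSup ((fun z => (Hy * Γ).mulVec z r) '' Z) := fun r =>
      exists_nonneg_sum_smul_eq_of_forall_le_on_polyhedron
        (fun i => LinearMap.proj i ∘ₗ Hx.mulVecLin) hx
        (LinearMap.proj r ∘ₗ (α • (Hy * A)).mulVecLin) _ hXne (fun x hxX => by
          suffices sSup ((fun z => (Hy * Γ).mulVec z r) '' Z) ≤
              β * hy r - (α • (Hy * A)).mulVec x r by
            simp only [LinearMap.comp_apply, LinearMap.proj_apply, Matrix.mulVecLin_apply]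
            linarith
          refine csSup_le (hZne.image _) ?_
          rintro _ ⟨z, hz, rfl⟩
          have hle : Hy.mulVec (α • A.mulVec x + Γ.mulVec z) ≤ β • hy :=
            hsub (Set.smul_mem_smul_set ⟨x, hxX, rfl⟩) _ ⟨z, hz, rfl⟩
          rw [hmem] at hle
          have := hle r
          simp only [Pi.add_apply, Pi.smul_apply, smul_eq_mul] at this
          linarith)
    choose Λ hΛ heq hle using key
    refine ⟨Matrix.of Λ, hΛ, ?_, fun r => hle r⟩
    refine Matrix.ext_of_mulVec_single fun j => funext fun r => ?_
    rw [← Matrix.mulVec_mulVec, heq]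
    rfl
  · rintro ⟨Λ, hΛ, heq, hle⟩ _ ⟨_, ⟨x, hxX, rfl⟩, rfl⟩ _ ⟨z, hz, rfl⟩
    change Hy.mulVec (α • A.mulVec x + Γ.mulVec z) ≤ β • hy
    rw [hmem, ← heq, ← Matrix.mulVec_mulVec]
    intro r
    have hsup : (Hy * Γ).mulVec z r ≤ sSup ((fun z => (Hy * Γ).mulVec z r) '' Z) :=
      le_csSup (hZcompact.image (by fun_prop)).bddAbove ⟨z, hz, rfl⟩
    have hmul : Λ.mulVec (Hx.mulVec x) r ≤ Λ.mulVec hx r :=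
      dotProduct_le_dotProduct_of_nonneg_left hxX (hΛ r)
    have := hle r
    simp only [Pi.add_apply, Pi.sub_apply] at this ⊢
    linarith
end
end

section
/- Consider a scalar β ≥ 0, a vector a ∈ ℝⁿ, an integer N ≥ 1, matrices A_i ∈ ℝ^{n×n} for i = 0,…,N−1 and Γ ∈ ℝ^{n×n}, nonempty polytopes X_i = {x ∈ ℝⁿ : H_{x,i} x ≤ h_{x,i}} with H_{x,i} ∈ ℝ^{n_x×n}, a polytope parameterized by H_y ∈ ℝ^{n_y×n} and h_y ∈ ℝ^{n_y} with βY defined as {y ∈ ℝⁿ : H_y y ≤ βh_y}, and a nonempty compact convex set Z ⊂ ℝⁿ. Then the inclusion {a} ⊕ ⨁_{i=0}^{N−1} A_i X_i ⊆ βY ⊖ ΓZ holds if and only if there exist matrices Λ_i ∈ ℝ^{n_y×n_x}, i = 0,…,N−1, with Λ_i ≥ 0 entrywise, such that Λ_i H_{x,i} = H_y A_i for every i, and Σ_{i=0}^{N−1} Λ_i h_{x,i} ≤ βh_y − h_Z(ΓᵀH_yᵀ) − H_y a, where h_Z(ΓᵀH_yᵀ) ∈ ℝ^{n_y} is the vector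 whose r-th entry is sup_{z∈Z} (H_yΓz)_r. -/
open Pointwise

noncomputable section

/-- **Farkas' lemma** over an arbitrary real vector space: a linear functional that is nonpositive
wherever finitely many functionals are nonpositive is a nonnegative combination of them. -/
theorem exists_nonneg_combination_of_forall_nonpos {V ι : Type*} [AddCommGroup V] [Module ℝ V]
    (s : Finset ι) (g : ι → V →ₗ[ℝ] ℝ) (f : V →ₗ[ℝ] ℝ)
    (hf : ∀ x, (∀ j ∈ s, g j x ≤ 0) → f x ≤ 0) :
    ∃ c : ι → ℝ, (∀ j, 0 ≤ c j) ∧ ∀ x, f x = ∑ j ∈ s, c j * g j x := by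
  classical
  induction s using Finset.induction_on generalizing g f with
  | empty =>
    refine ⟨0, fun _ => le_rfl, fun x => ?_⟩
    have h₁ := hf x (by simp)
    have h₂ := hf (-x) (by simp)
    rw [map_neg] at h₂
    simp only [Finset.sum_empty]
    linarith
  | insert k s hk ih =>
    by_cases hs : ∀ x, (∀ j ∈ s, g j x ≤ 0) → f x ≤ 0
    · obtain ⟨c, hc, hfc⟩ := ih g f hs
      refine ⟨Function.update c k 0, fun j => ?_, fun x => ?_⟩
      · by_cases hj : j = k
        · simp [hj]
        · simpa [hj] using hc j
      · rw [Finset.sum_insert hk, hfc x, Function.update_self, zero_mul, zero_add]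
        refine Finset.sum_congr rfl fun j hj => ?_
        rw [Function.update_of_ne (ne_of_mem_of_not_mem hj hk)]
    · push Not at hs
      obtain ⟨u, hu, hfu⟩ := hs
      have hgu : 0 < g k u := by
        by_contra! h
        exact absurd (hf u fun j hj => (Finset.mem_insert.1 hj).elim (fun e => e ▸ h) (hu j))
          (not_le.2 hfu)
      set w : V := (g k u)⁻¹ • u with hw
      have hkw : g k w = 1 := by simp [hw, hgu.ne']
      have hsw : ∀ j ∈ s, g j w ≤ 0 := fun j hj => by
        rw [hw, map_smul, smul_eq_mul]
        exact mul_nonpos_of_nonneg_of_nonpos (inv_nonneg.2 hgu.le) (hu j hj)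
      have hfw : 0 < f w := by
        rw [hw, map_smul, smul_eq_mul]
        exact mul_pos (inv_pos.2 hgu) hfu
      obtain ⟨c, hc, hfc⟩ := ih (fun j => g j - g j w • g k) (f - f w • g k) fun x hx => by
        have h := hf (x - g k x • w) fun j hj => by
          rcases Finset.mem_insert.1 hj with rfl | hj
          · simp [hkw]
          · have := hx j hj
            simp only [LinearMap.sub_apply, LinearMap.smul_apply, smul_eq_mul] at this
            simp only [map_sub, map_smul, smul_eq_mul]
            linarith
        simp only [map_sub, map_smul, smul_eq_mul] at h
        simp only [LinearMap.sub_apply, LinearMap.smul_apply, smul_eq_mul]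
        linarith
      have hcw : ∑ j ∈ s, c j * g j w ≤ 0 :=
        Finset.sum_nonpos fun j hj => mul_nonpos_of_nonneg_of_nonpos (hc j) (hsw j hj)
      refine ⟨Function.update c k (f w - ∑ j ∈ s, c j * g j w), fun j => ?_, fun x => ?_⟩
      · by_cases hj : j = k
        · subst hj
          rw [Function.update_self]
          linarith
        · simpa [hj] using hc j
      · have h := hfc x
        simp only [LinearMap.sub_apply, LinearMap.smul_apply, smul_eq_mul, mul_sub,
          Finset.sum_sub_distrib, ← mul_assoc, ← Finset.sum_mul] at h
        have h' : ∑ j ∈ s, Function.update c k (f w - ∑ j ∈ s, c j * g j w) j * g j x =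
            ∑ j ∈ s, c j * g j x := Finset.sum_congr rfl fun j hj => by
          rw [Function.update_of_ne (ne_of_mem_of_not_mem hj hk)]
        rw [Finset.sum_insert hk, h', Function.update_self]
        linarith

/-- **Affine Farkas' lemma**: a linear inequality valid on a nonempty polyhedron is implied by a
nonnegative combination of the inequalities defining it. -/
theorem exists_nonneg_combination_of_forall_le {V ι : Type*} [AddCommGroup V] [Module ℝ V]
    (s : Finset ι) (g : ι → V →ₗ[ℝ] ℝ) (b : ι → ℝ) (f : V →ₗ[ℝ] ℝ) (d : ℝ)
    (hne : ∃ x, ∀ j ∈ s, g j x ≤ b j) (hf : ∀ x, (∀ j ∈ s, g j x ≤ b j) → f x ≤ d) :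
    ∃ c : ι → ℝ, (∀ j, 0 ≤ c j) ∧ (∀ x, f x = ∑ j ∈ s, c j * g j x) ∧
      ∑ j ∈ s, c j * b j ≤ d := by
  obtain ⟨x₀, hx₀⟩ := hne
  let G : Option ι → V × ℝ →ₗ[ℝ] ℝ := fun o =>
    o.elim (-LinearMap.snd ℝ V ℝ)
      fun j => g j ∘ₗ LinearMap.fst ℝ V ℝ - b j • LinearMap.snd ℝ V ℝ
  obtain ⟨c, hc, hfc⟩ := exists_nonneg_combination_of_forall_nonpos (Finset.insertNone s) G
    (f ∘ₗ LinearMap.fst ℝ V ℝ - d • LinearMap.snd ℝ V ℝ) (by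
      rintro ⟨x, t⟩ h
      have ht : 0 ≤ t := by simpa [G] using h none (by simp)
      have hx : ∀ j ∈ s, g j x ≤ b j * t := fun j hj => by
        simpa [G] using h (some j) (by simpa using hj)
      suffices f x ≤ d * t by simpa using this
      rcases ht.eq_or_lt with rfl | ht
      · by_contra! hpos
        rw [mul_zero] at hpos
        have h₁ : f (x₀ + ((d - f x₀ + 1) / f x) • x) ≤ d := by
          refine hf _ fun j hj => ?_
          have h₂ := hx j hj
          have h₃ : 0 ≤ (d - f x₀ + 1) / f x :=
            div_nonneg (by linarith [hf x₀ hx₀]) hpos.le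
          rw [map_add, map_smul, smul_eq_mul]
          nlinarith [hx₀ j hj]
        rw [map_add, map_smul, smul_eq_mul, div_mul_cancel₀ _ hpos.ne'] at h₁
        linarith
      · have h₁ : f (t⁻¹ • x) ≤ d := hf _ fun j hj => by
          rw [map_smul, smul_eq_mul, inv_mul_le_iff₀ ht, mul_comm]
          exact hx j hj
        rwa [map_smul, smul_eq_mul, inv_mul_le_iff₀ ht, mul_comm] at h₁)
  refine ⟨fun j => c (some j), fun j => hc _, fun x => ?_, ?_⟩
  · simpa [G] using hfc (x, 0)
  · have h := hfc (0, 1)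
    simp only [Finset.sum_insertNone, G] at h
    simp at h
    linarith [hc none]

/-- Lemma 4 of the paper: the inclusion `{a} ⊕ ⨁ᵢ Aᵢ Xᵢ ⊆ βY ⊖ ΓZ` holds if and only if
there are entrywise nonnegative matrices `Λᵢ` with `Λᵢ H_{x,i} = Hy Aᵢ` and
`Σᵢ Λᵢ h_{x,i} ≤ β hy − h_Z(Γᵀ Hyᵀ) − Hy a`. -/
theorem minkowski_inclusion_iff {n nx ny : ℕ} (N : ℕ) (hN : 1 ≤ N)
    (β : ℝ) (hβ : 0 ≤ β) (a : Vec n)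
    (A : ℕ → Mat n n) (Γ : Mat n n)
    (Hx : ℕ → Matrix (Fin nx) (Fin n) ℝ) (hx : ℕ → (Fin nx → ℝ))
    (hXne : ∀ i < N, {x : Vec n | (Hx i).mulVec x ≤ hx i}.Nonempty)
    (Hy : Matrix (Fin ny) (Fin n) ℝ) (hy : Fin ny → ℝ)
    (Z : Set (Vec n)) (hZne : Z.Nonempty) (hZcompact : IsCompact Z) (hZconvex : Convex ℝ Z) :
    ({a} : Set (Vec n)) + (∑ i ∈ Finset.range N, mset (A i) {x : Vec n | (Hx i).mulVec x ≤ hx i})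
        ⊆ pontryagin {y : Vec n | Hy.mulVec y ≤ β • hy} (mset Γ Z) ↔
      ∃ Λ : ℕ → Matrix (Fin ny) (Fin nx) ℝ,
        (∀ i < N, ∀ r c, 0 ≤ Λ i r c) ∧
        (∀ i < N, Λ i * Hx i = Hy * A i) ∧
        (∑ i ∈ Finset.range N, (Λ i).mulVec (hx i))
          ≤ β • hy - (fun r => sSup ((fun z => (Hy * Γ).mulVec z r) '' Z)) - Hy.mulVec a := by
  have hbdd : ∀ r, BddAbove ((fun z => (Hy * Γ).mulVec z r) '' Z) := fun r =>
    (hZcompact.image ((continuous_apply r).comp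
      (Continuous.matrix_mulVec continuous_const continuous_id))).bddAbove
  have hsum : ∀ (X : ℕ → Vec n) r, Hy.mulVec (∑ i ∈ Finset.range N, (A i).mulVec (X i)) r =
      ∑ i ∈ Finset.range N, (Hy * A i).mulVec (X i) r := fun X r => by
    simp only [← Matrix.mulVec_mulVec, Matrix.mulVec_sum, Finset.sum_apply]
  constructor
  · intro hsub
    have hrow : ∀ r, ∃ c : ℕ × Fin nx → ℝ, (∀ i k, 0 ≤ c (i, k)) ∧
        (∀ X : ℕ → Vec n, ∑ i ∈ Finset.range N, (Hy * A i).mulVec (X i) r =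
          ∑ i ∈ Finset.range N, ∑ k, c (i, k) * (Hx i).mulVec (X i) k) ∧
        ∑ i ∈ Finset.range N, ∑ k, c (i, k) * hx i k ≤
          β * hy r - sSup ((fun z => (Hy * Γ).mulVec z r) '' Z) - Hy.mulVec a r := by
      intro r
      have key := exists_nonneg_combination_of_forall_le (V := ℕ → Vec n)
        (Finset.range N ×ˢ (Finset.univ : Finset (Fin nx)))
        (fun j => LinearMap.proj j.2 ∘ₗ (Hx j.1).mulVecLin ∘ₗ LinearMap.proj j.1)
        (fun j => hx j.1 j.2)
        (∑ i ∈ Finset.range N, LinearMap.proj r ∘ₗ (Hy * A i).mulVecLin ∘ₗ LinearMap.proj i)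
        (β * hy r - sSup ((fun z => (Hy * Γ).mulVec z r) '' Z) - Hy.mulVec a r)
      simp only [Finset.sum_product, LinearMap.sum_apply, LinearMap.comp_apply,
        LinearMap.proj_apply, Matrix.mulVecLin_apply, Finset.mem_product, Finset.mem_univ,
        and_true, Finset.mem_range, Prod.forall] at key
      refine key ?_ fun X hX => ?_
      · choose! X hX using hXne
        exact ⟨X, fun i k hi => hX i hi k⟩
      · have hmem := hsub (Set.add_mem_add (Set.mem_singleton a) (Set.mem_finsetSum (Finset.range N)
          (fun i => mset (A i) {x : Vec n | (Hx i).mulVec x ≤ hx i}) _ |>.2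
          ⟨fun i => (A i).mulVec (X i), fun {i} hi =>
            ⟨X i, fun k => hX i k (Finset.mem_range.1 hi), rfl⟩, rfl⟩))
        have hle : sSup ((fun z => (Hy * Γ).mulVec z r) '' Z) ≤
            β * hy r - Hy.mulVec a r - ∑ i ∈ Finset.range N, (Hy * A i).mulVec (X i) r := by
          refine csSup_le (hZne.image _) ?_
          rintro _ ⟨z, hz, rfl⟩
          have h := hmem _ ⟨z, hz, rfl⟩ r
          simp only [Matrix.mulVec_add, Pi.add_apply, hsum, Matrix.mulVec_mulVec, Pi.smul_apply,
            smul_eq_mul] at h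
          linarith
        linarith
    choose c hc hcA hcb using hrow
    refine ⟨fun i => Matrix.of fun r k => c r (i, k), fun i _ r k => hc r i k, fun i hi => ?_, ?_⟩
    · ext r l
      have h := hcA r (Pi.single i (Pi.single l 1))
      have hz : ∀ j ∈ Finset.range N, j ≠ i →
          (Pi.single i (Pi.single l 1) : ℕ → Vec n) j = 0 := fun j _ hj =>
        Pi.single_eq_of_ne hj _
      rw [Finset.sum_eq_single_of_mem i (Finset.mem_range.2 hi)
          fun j hj hji => by rw [hz j hj hji]; simp,
        Finset.sum_eq_single_of_mem i (Finset.mem_range.2 hi)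
          fun j hj hji => by rw [hz j hj hji]; simp] at h
      simp only [Pi.single_eq_same, Matrix.mulVec_single_one, Matrix.col_apply] at h
      rw [h]
      simp [Matrix.mul_apply]
    · intro r
      simpa [Finset.sum_apply, Matrix.mulVec, dotProduct] using hcb r
  · rintro ⟨Λ, hΛ, hΛA, hΛb⟩ _ ⟨_, rfl, y, hy', rfl⟩ _ ⟨z, hz, rfl⟩ r
    obtain ⟨Y, hY, rfl⟩ := (Set.mem_finsetSum _ _ _).1 hy'
    have hX : ∀ i ∈ Finset.range N, ∃ x, (Hx i).mulVec x ≤ hx i ∧ (A i).mulVec x = Y i :=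
      fun i hi => hY hi
    choose! X hX hXY using hX
    have h₁ : ∑ i ∈ Finset.range N, (Hy * A i).mulVec (X i) r ≤
        ∑ i ∈ Finset.range N, (Λ i).mulVec (hx i) r := Finset.sum_le_sum fun i hi => by
      rw [← hΛA i (Finset.mem_range.1 hi), ← Matrix.mulVec_mulVec]
      exact dotProduct_le_dotProduct_of_nonneg_left (hX i hi) (hΛ i (Finset.mem_range.1 hi) r)
    have h₂ := le_csSup (hbdd r) ⟨z, hz, rfl⟩
    have h₃ := hΛb r
    simp only [Finset.sum_apply, Pi.sub_apply, Pi.smul_apply, smul_eq_mul] at h₃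
    rw [← Finset.sum_congr rfl hXY]
    simp only [Matrix.mulVec_add, Pi.add_apply, hsum, Matrix.mulVec_mulVec, Pi.smul_apply,
      smul_eq_mul]
    linarith
end
end
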